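/- Let (Y^(n)) be an irreducible (finite-state, homogeneous) Markov chain whose state space is a finite field 𝔉, with transition matrix P and invariant distribution π. Then every rate R > H(P|π) is achievable with linear coding over 𝔉: for any ε > 0 there is N₀ ∈ ℕ⁺ such that for all n > N₀ there exist a linear encoder φ : 𝔉^n → 𝔉^k (given by a k×n matrix over 𝔉) with k·log|𝔉| ≤ nR and a decoder ψ : 𝔉^k → 𝔉^n with Pr{ψ(φ(Y^n)) ≠ Y^n} < ε, where Y^n = [Y^(1),…,Y^(n)]. -/

import Mathlib

open Finset

/-- `N(i,j;x)`: number of occurrences of the consecutive pair `[i, j]` in the sequence `x`. -/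
noncomputable def pairCount {X : Type*} [DecidableEq X] (x : List X) (i j : X) : ℕ :=
  (x.zip x.tail).count (i, j)

/-- `N(i;x) = ∑_j N(i,j;x)`. -/
noncomputable def stateCount {X : Type*} [Fintype X] [DecidableEq X] (x : List X) (i : X) : ℕ :=
  ∑ j, pairCount x i j

/-- `x` is strongly Markov ε-typical with respect to the stochastic matrix `Q`
whose invariant distribution is `q`. -/
def SMTypical {X : Type*} [Fintype X] [DecidableEq X]
    (Q : X → X → ℝ) (q : X → ℝ) (ε : ℝ) (x : List X) : Prop :=
  ∀ i j : X,
    |(pairCount x i j : ℝ) / (stateCount x i : ℝ) - Q i j| < ε ∧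
    |(stateCount x i : ℝ) / (x.length : ℝ) - q i| < ε

/-- `P` is a stochastic matrix. -/
def IsStochasticMat {X : Type*} [Fintype X] (P : X → X → ℝ) : Prop :=
  (∀ i j, 0 ≤ P i j) ∧ ∀ i, ∑ j, P i j = 1

/-- `P` is irreducible: there is no nonempty `A ⊊ X` with `P_{A,Aᶜ} = 0`. -/
def IsIrreducibleMat {X : Type*} [Fintype X] (P : X → X → ℝ) : Prop :=
  ∀ A : Finset X, A.Nonempty → A ≠ Finset.univ → ∃ i ∈ A, ∃ j ∉ A, P i j ≠ 0

/-- `π` is an invariant (stationary) distribution of `P`. -/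
def IsInvariantDist {X : Type*} [Fintype X] (P : X → X → ℝ) (π : X → ℝ) : Prop :=
  (∀ i, 0 ≤ π i) ∧ ∑ i, π i = 1 ∧ ∀ j, ∑ i, π i * P i j = π j

/-- Probability that the stationary Markov chain with initial (invariant) distribution `π`
and transition matrix `P` emits the finite path `x`. -/
noncomputable def pathProb {X : Type*} (π : X → ℝ) (P : X → X → ℝ) (x : List X) : ℝ :=
  (x.head?.elim 1 π) * ((x.zip x.tail).map fun p => P p.1 p.2).prod

/-- `H(P|π) = -∑_{i,j} π_i P_{ij} log₂ P_{ij}`. -/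
noncomputable def mcCondEnt {X : Type*} [Fintype X] (P : X → X → ℝ) (π : X → ℝ) : ℝ :=
  -∑ i, ∑ j, π i * P i j * Real.logb 2 (P i j)

section MarkovPaths

variable {X : Type*}

/-- Probability of following the path `l` when starting from the state `i`. -/
def pathWeight (P : X → X → ℝ) : X → List X → ℝ
  | _, [] => 1
  | i, j :: l => P i j * pathWeight P j l

/-- Sum of `d` over the consecutive pairs of the path `i :: l`. -/
def pathSum (d : X → X → ℝ) : X → List X → ℝ
  | _, [] => 0
  | i, j :: l => d i j + pathSum d j l

theorem pathProb_cons (π : X → ℝ) (P : X → X → ℝ) (i : X) (l : List X) :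
    pathProb π P (i :: l) = π i * pathWeight P i l := by
  have h : ∀ (l : List X) (i : X),
      (((i :: l).zip l).map fun p => P p.1 p.2).prod = pathWeight P i l := by
    intro l
    induction l with
    | nil => simp [pathWeight]
    | cons j l ih => intro i; simp [pathWeight, ← ih j]
  simp [pathProb, ← h l i]

theorem pathWeight_nonneg {P : X → X → ℝ} (hP : ∀ i j, 0 ≤ P i j) (i : X) (l : List X) :
    0 ≤ pathWeight P i l := by
  induction l generalizing i with
  | nil => simp [pathWeight]
  | cons j l ih => exact mul_nonneg (hP i j) (ih j)

theorem neg_logb_pathWeight {P : X → X → ℝ} (i : X) (l : List X) (h : pathWeight P i l ≠ 0) :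
    -Real.logb 2 (pathWeight P i l) = pathSum (fun i j => -Real.logb 2 (P i j)) i l := by
  induction l generalizing i with
  | nil => simp [pathWeight, pathSum]
  | cons j l ih =>
    have h' : P i j * pathWeight P j l ≠ 0 := h
    have h1 := left_ne_zero_of_mul h'
    have h2 := right_ne_zero_of_mul h'
    simp only [pathWeight, pathSum]
    rw [Real.logb_mul h1 h2, ← ih j h2]
    ring

theorem pathSum_le_add_coboundary {d f : X → X → ℝ} {h : X → ℝ} {H b : ℝ}
    (hd : ∀ i j, d i j = f i j - H - h i + h j) (hb : ∀ i, b ≤ h i) (i : X) (l : List X) :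
    pathSum f i l ≤ pathSum d i l + l.length * H + h i - b := by
  induction l generalizing i with
  | nil => simpa [pathSum] using hb i
  | cons j l ih =>
    have := ih j
    simp only [pathSum, List.length_cons, hd i j]
    push_cast
    linarith

theorem sum_ofFn_succ [Fintype X] (m : ℕ) (φ : List X → ℝ) :
    ∑ y : Fin (m + 1) → X, φ (List.ofFn y) =
      ∑ i, ∑ y : Fin m → X, φ (i :: List.ofFn y) := by
  rw [← (Fin.consEquiv fun _ : Fin (m + 1) => X).sum_comp, Fintype.sum_prod_type]
  simp [Fin.consEquiv, List.ofFn_succ]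

theorem sum_pathWeight [Fintype X] {P : X → X → ℝ} (hP : IsStochasticMat P) (m : ℕ) (i : X) :
    ∑ y : Fin m → X, pathWeight P i (List.ofFn y) = 1 := by
  induction m generalizing i with
  | zero => simp [pathWeight]
  | succ m ih =>
    rw [sum_ofFn_succ m (pathWeight P i)]
    simp only [pathWeight, ← Finset.mul_sum, ih, mul_one, hP.2]

theorem sum_pathWeight_mul_pathSum [Fintype X] {P d : X → X → ℝ} (hP : IsStochasticMat P)
    (hd : ∀ i, ∑ j, P i j * d i j = 0) (m : ℕ) (i : X) :
    ∑ y : Fin m → X, pathWeight P i (List.ofFn y) * pathSum d i (List.ofFn y) = 0 := by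
  induction m generalizing i with
  | zero => simp [pathSum]
  | succ m ih =>
    rw [sum_ofFn_succ m (fun l => pathWeight P i l * pathSum d i l), ← hd i]
    refine Finset.sum_congr rfl fun j _ => ?_
    have : ∀ l : List X, pathWeight P i (j :: l) * pathSum d i (j :: l) =
        P i j * d i j * pathWeight P j l + P i j * (pathWeight P j l * pathSum d j l) := by
      intro l; simp only [pathWeight, pathSum]; ring
    simp only [this, Finset.sum_add_distrib, ← Finset.mul_sum, ih, sum_pathWeight hP]
    ring

theorem sum_pathWeight_mul_pathSum_sq_le [Fintype X] {P d : X → X → ℝ} {C : ℝ}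
    (hP : IsStochasticMat P) (hd : ∀ i, ∑ j, P i j * d i j = 0)
    (hC : ∀ i, ∑ j, P i j * d i j ^ 2 ≤ C) (m : ℕ) (i : X) :
    ∑ y : Fin m → X, pathWeight P i (List.ofFn y) * pathSum d i (List.ofFn y) ^ 2 ≤ m * C := by
  induction m generalizing i with
  | zero => simp [pathSum]
  | succ m ih =>
    rw [sum_ofFn_succ m (fun l => pathWeight P i l * pathSum d i l ^ 2)]
    have : ∀ (j : X) (l : List X), pathWeight P i (j :: l) * pathSum d i (j :: l) ^ 2 =
        P i j * d i j ^ 2 * pathWeight P j l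
          + 2 * P i j * d i j * (pathWeight P j l * pathSum d j l)
          + P i j * (pathWeight P j l * pathSum d j l ^ 2) := by
      intro j l; simp only [pathWeight, pathSum]; ring
    simp only [this, Finset.sum_add_distrib, ← Finset.mul_sum, sum_pathWeight hP,
      sum_pathWeight_mul_pathSum hP hd, mul_zero, mul_one, add_zero]
    have h2 : ∑ j, P i j * ∑ y : Fin m → X,
        pathWeight P j (List.ofFn y) * pathSum d j (List.ofFn y) ^ 2 ≤ ∑ j, P i j * (m * C) :=
      Finset.sum_le_sum fun j _ => mul_le_mul_of_nonneg_left (ih j) (hP.1 i j)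
    rw [← Finset.sum_mul, hP.2 i] at h2
    push_cast
    linarith [hC i]

/-- Maximum principle: harmonic functions of an irreducible chain are constant. -/
theorem IsIrreducibleMat.eq_of_harmonic [Fintype X] {P : X → X → ℝ} (hP : IsStochasticMat P)
    (hirr : IsIrreducibleMat P) {h : X → ℝ} (hh : ∀ i, ∑ j, P i j * h j = h i) (a b : X) :
    h a = h b := by
  classical
  obtain ⟨c, -, hc⟩ := Finset.exists_max_image Finset.univ h ⟨a, Finset.mem_univ a⟩
  have hc' : ∀ j, h j ≤ h c := fun j => hc j (Finset.mem_univ j)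
  suffices hA : Finset.univ.filter (fun i => h i = h c) = Finset.univ by
    have key : ∀ i, h i = h c := fun i => by simpa using hA.ge (Finset.mem_univ i)
    rw [key a, key b]
  by_contra hne
  obtain ⟨i, hi, j, hj, hij⟩ := hirr _ ⟨c, by simp⟩ hne
  simp only [Finset.mem_filter, Finset.mem_univ, true_and] at hi hj
  have hlt : ∑ j, P i j * h j < ∑ j, P i j * h c :=
    Finset.sum_lt_sum (fun j _ => mul_le_mul_of_nonneg_left (hc' j) (hP.1 i j))
      ⟨j, Finset.mem_univ j, mul_lt_mul_of_pos_left (lt_of_le_of_ne (hc' j) hj)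
        (lt_of_le_of_ne (hP.1 i j) hij.symm)⟩
  rw [hh i, ← Finset.sum_mul, hP.2 i, hi] at hlt
  linarith

/-- Solvability of the Poisson equation of an irreducible chain. -/
theorem IsIrreducibleMat.exists_poisson [Fintype X] {P : X → X → ℝ} {π : X → ℝ}
    (hP : IsStochasticMat P) (hirr : IsIrreducibleMat P) (hπ : IsInvariantDist P π)
    {g : X → ℝ} (hg : ∑ i, π i * g i = 0) :
    ∃ h : X → ℝ, ∀ i, h i - ∑ j, P i j * h j = g i := by
  classical
  let T : (X → ℝ) →ₗ[ℝ] (X → ℝ) := LinearMap.id - Matrix.mulVecLin (Matrix.of P)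
  let ℓ : (X → ℝ) →ₗ[ℝ] ℝ := ∑ i, π i • LinearMap.proj i
  have hT : ∀ h i, T h i = h i - ∑ j, P i j * h j := fun h i => by
    simp [T, Matrix.mulVec, dotProduct]
  have hl : ∀ v, ℓ v = ∑ i, π i * v i := fun v => by simp [ℓ]
  have hle : LinearMap.range T ≤ LinearMap.ker ℓ := by
    rintro _ ⟨h, rfl⟩
    rw [LinearMap.mem_ker, hl]
    simp only [hT, mul_sub, Finset.sum_sub_distrib, Finset.mul_sum]
    rw [Finset.sum_comm, sub_eq_zero]
    refine Finset.sum_congr rfl fun j _ => ?_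
    simp only [← mul_assoc, ← Finset.sum_mul, hπ.2.2 j]
  have hker : Module.finrank ℝ (LinearMap.ker T) ≤ 1 := by
    refine finrank_le_one (⟨fun _ => 1, ?_⟩ : LinearMap.ker T) ?_
    · rw [LinearMap.mem_ker]
      ext i
      simp [hT, hP.2]
    · rintro ⟨h, hh⟩
      rw [LinearMap.mem_ker] at hh
      have hharm : ∀ i, ∑ j, P i j * h j = h i := fun i => by
        have := congrFun hh i
        rw [hT] at this
        simp only [Pi.zero_apply] at this
        linarith
      rcases isEmpty_or_nonempty X with hX | ⟨⟨x⟩⟩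
      · exact ⟨0, Subsingleton.elim _ _⟩
      · refine ⟨h x, Subtype.ext (funext fun i => ?_)⟩
        simp [hirr.eq_of_harmonic hP hharm x i]
  have hl1 : ℓ (fun _ => 1) = 1 := by rw [hl]; simp [hπ.2.1]
  have hsurj : Function.Surjective ℓ := fun r => ⟨r • fun _ => 1, by rw [map_smul, hl1]; simp⟩
  have h1 := LinearMap.finrank_range_add_finrank_ker T
  have h2 := LinearMap.finrank_range_add_finrank_ker ℓ
  rw [LinearMap.range_eq_top.2 hsurj, finrank_top, Module.finrank_self] at h2
  have heq : LinearMap.range T = LinearMap.ker ℓ :=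
    Submodule.eq_of_le_of_finrank_le hle (by omega)
  have hgm : g ∈ LinearMap.range T := by rw [heq, LinearMap.mem_ker, hl, hg]
  obtain ⟨h, hh⟩ := hgm
  exact ⟨h, fun i => by rw [← hT, hh]⟩

theorem mcCondEnt_nonneg [Fintype X] {P : X → X → ℝ} {π : X → ℝ} (hP : IsStochasticMat P)
    (hπ : IsInvariantDist P π) : 0 ≤ mcCondEnt P π := by
  rw [mcCondEnt, neg_nonneg]
  refine Finset.sum_nonpos fun i _ => Finset.sum_nonpos fun j _ => ?_
  have h1 : P i j ≤ 1 :=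
    (hP.2 i).symm ▸ Finset.single_le_sum (fun j _ => hP.1 i j) (Finset.mem_univ j)
  exact mul_nonpos_of_nonneg_of_nonpos (mul_nonneg (hπ.1 i) (hP.1 i j))
    (Real.logb_nonpos one_lt_two (hP.1 i j) h1)

/-- Weak asymptotic equipartition property: a path of low weight is improbable, from any
starting state. -/
theorem exists_sum_low_pathWeight_le [Fintype X] {P : X → X → ℝ} {π : X → ℝ}
    (hP : IsStochasticMat P) (hirr : IsIrreducibleMat P) (hπ : IsInvariantDist P π)
    {δ : ℝ} (hδ : 0 < δ) :
    ∃ C M : ℝ, ∀ m : ℕ, M < m → ∀ i : X,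
      ∑ y : Fin m → X with
          pathWeight P i (List.ofFn y) < (2 : ℝ) ^ (-(m * (mcCondEnt P π + δ))),
        pathWeight P i (List.ofFn y) ≤ C / m := by
  set H := mcCondEnt P π with hH
  let f : X → X → ℝ := fun i j => -Real.logb 2 (P i j)
  obtain ⟨h, hh⟩ := hirr.exists_poisson hP hπ (g := fun i => ∑ j, P i j * f i j - H) (by
    have : ∑ i, π i * ∑ j, P i j * f i j = H := by
      simp only [hH, mcCondEnt, f, Finset.mul_sum, ← Finset.sum_neg_distrib]
      exact Finset.sum_congr rfl fun i _ => Finset.sum_congr rfl fun j _ => by ring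
    simp only [mul_sub, Finset.sum_sub_distrib, ← Finset.sum_mul, hπ.2.1, this]
    ring)
  let d : X → X → ℝ := fun i j => f i j - H - h i + h j
  have hd : ∀ i, ∑ j, P i j * d i j = 0 := fun i => by
    have : ∀ j, P i j * d i j = P i j * f i j - P i j * (H + h i) + P i j * h j := fun j => by
      simp only [d]; ring
    simp only [this, Finset.sum_add_distrib, Finset.sum_sub_distrib, ← Finset.sum_mul, hP.2]
    linarith [hh i]
  obtain ⟨C, hC⟩ : ∃ C, ∀ i, ∑ j, P i j * d i j ^ 2 ≤ C :=
    let ⟨C, hC⟩ := (Set.finite_range fun i => ∑ j, P i j * d i j ^ 2).bddAbove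
    ⟨C, fun i => hC ⟨i, rfl⟩⟩
  obtain ⟨b, hb⟩ : ∃ b, ∀ i, b ≤ h i :=
    let ⟨b, hb⟩ := (Set.finite_range h).bddBelow
    ⟨b, fun i => hb ⟨i, rfl⟩⟩
  obtain ⟨B, hB⟩ : ∃ B, ∀ i, h i ≤ B :=
    let ⟨B, hB⟩ := (Set.finite_range h).bddAbove
    ⟨B, fun i => hB ⟨i, rfl⟩⟩
  refine ⟨4 * C / δ ^ 2, max 0 (2 * (B - b) / δ), fun m hm i => ?_⟩
  have hm0 : (0 : ℝ) < m := (le_max_left _ _).trans_lt hm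
  have hmB : 2 * (B - b) < m * δ := by
    have := (le_max_right _ _).trans_lt hm
    rwa [div_lt_iff₀ hδ] at this
  have hsq : 0 < (m * δ / 2) ^ 2 := by positivity
  have hbound : ∀ y : Fin m → X,
      pathWeight P i (List.ofFn y) < (2 : ℝ) ^ (-(m * (H + δ))) →
      pathWeight P i (List.ofFn y) * (m * δ / 2) ^ 2 ≤
        pathWeight P i (List.ofFn y) * pathSum d i (List.ofFn y) ^ 2 := by
    intro y hy
    rcases (pathWeight_nonneg hP.1 i (List.ofFn y)).eq_or_lt with h0 | h0
    · simp [← h0]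
    have h1 := neg_logb_pathWeight i (List.ofFn y) h0.ne'
    have h2 := pathSum_le_add_coboundary (d := d) (f := f) (fun _ _ => rfl) hb i (List.ofFn y)
    rw [List.length_ofFn] at h2
    have h3 : Real.logb 2 (pathWeight P i (List.ofFn y)) < -(m * (H + δ)) :=
      (Real.logb_lt_iff_lt_rpow one_lt_two h0).2 hy
    have h4 : m * δ / 2 ≤ pathSum d i (List.ofFn y) := by
      have h5 : pathSum f i (List.ofFn y) = -Real.logb 2 (pathWeight P i (List.ofFn y)) := h1.symm
      linarith [hB i]
    gcongr
  have hle : (∑ y : Fin m → X with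
        pathWeight P i (List.ofFn y) < (2 : ℝ) ^ (-(m * (H + δ))),
      pathWeight P i (List.ofFn y)) * (m * δ / 2) ^ 2 ≤ m * C := by
    rw [Finset.sum_mul]
    calc _ ≤ ∑ y : Fin m → X with pathWeight P i (List.ofFn y) < (2 : ℝ) ^ (-(m * (H + δ))),
          pathWeight P i (List.ofFn y) * pathSum d i (List.ofFn y) ^ 2 :=
          Finset.sum_le_sum fun y hy => hbound y (Finset.mem_filter.1 hy).2
      _ ≤ ∑ y : Fin m → X, pathWeight P i (List.ofFn y) * pathSum d i (List.ofFn y) ^ 2 :=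
          Finset.sum_le_sum_of_subset_of_nonneg (Finset.filter_subset _ _) fun y _ _ =>
            mul_nonneg (pathWeight_nonneg hP.1 i _) (sq_nonneg _)
      _ ≤ m * C := sum_pathWeight_mul_pathSum_sq_le hP hd hC m i
  rw [← le_div_iff₀ hsq] at hle
  refine hle.trans_eq ?_
  field_simp
  norm_num

end MarkovPaths

section RandomLinearCoding

variable {F : Type*} [Field F] [Fintype F] [DecidableEq F]

theorem card_mulVec_eq_zero_mul {k n : ℕ} {z : Fin n → F} (hz : z ≠ 0) :
    #{A : Matrix (Fin k) (Fin n) F | A.mulVec z = 0} * Fintype.card F ^ k =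
      Fintype.card (Matrix (Fin k) (Fin n) F) := by
  let T : Matrix (Fin k) (Fin n) F →+ (Fin k → F) :=
    { toFun := fun A => A.mulVec z
      map_zero' := Matrix.zero_mulVec z
      map_add' := fun A B => Matrix.add_mulVec A B z }
  have hsurj : Function.Surjective T := by
    intro w
    obtain ⟨j, hj⟩ := Function.ne_iff.1 hz
    refine ⟨Matrix.of fun i j' => if j' = j then w i * (z j)⁻¹ else 0, ?_⟩
    ext i
    have hj' : z j ≠ 0 := hj
    simp [T, Matrix.mulVec, dotProduct, hj']
  have h1 := T.ker.card_mul_index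
  rw [AddSubgroup.index_ker, AddMonoidHom.range_eq_top.2 hsurj] at h1
  simp only [AddSubgroup.card_top, Nat.card_eq_fintype_card, Fintype.card_fun,
    Fintype.card_fin] at h1
  rw [← h1]
  congr 1
  rw [← Fintype.card_subtype]
  exact Fintype.card_congr (Equiv.refl _)

/-- Random linear coding: some linear encoder fails on a set `S` of messages with probability
at most `#S / |F| ^ k`. -/
theorem exists_linear_code {k n : ℕ} (S : Finset (Fin n → F)) {p : (Fin n → F) → ℝ}
    (hp : ∀ y, 0 ≤ p y) (hp1 : ∑ y, p y = 1) :
    ∃ (A : Matrix (Fin k) (Fin n) F) (ψ : (Fin k → F) → (Fin n → F)),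
      ∑ y, Set.indicator {y | ψ (A.mulVec y) ≠ y} p y ≤
        ∑ y with y ∉ S, p y + #S / (Fintype.card F : ℝ) ^ k := by
  classical
  have hdec : ∀ A : Matrix (Fin k) (Fin n) F, ∃ ψ : (Fin k → F) → (Fin n → F),
      ∀ y ∈ S, ψ (A.mulVec y) ∈ S ∧ A.mulVec (ψ (A.mulVec y)) = A.mulVec y := by
    intro A
    refine ⟨fun s => if h : ∃ y ∈ S, A.mulVec y = s then h.choose else 0, fun y hy => ?_⟩
    have h : ∃ y' ∈ S, A.mulVec y' = A.mulVec y := ⟨y, hy, rfl⟩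
    simp only [dif_pos h]
    exact h.choose_spec
  choose ψ hψ using hdec
  have hq : (0 : ℝ) < (Fintype.card F : ℝ) ^ k := by
    have : 0 < Fintype.card F := Fintype.card_pos
    positivity
  let c : ℝ := Fintype.card (Matrix (Fin k) (Fin n) F)
  have hpt : ∀ (A : Matrix (Fin k) (Fin n) F) y,
      Set.indicator {y | ψ A (A.mulVec y) ≠ y} p y ≤
        (if y ∉ S then p y else 0) +
          p y * ∑ y' ∈ S, if y' - y ≠ 0 ∧ A.mulVec (y' - y) = 0 then 1 else 0 := by
    intro A y
    have hnn : 0 ≤ ∑ y' ∈ S, if y' - y ≠ 0 ∧ A.mulVec (y' - y) = 0 then (1 : ℝ) else 0 :=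
      Finset.sum_nonneg fun _ _ => by split_ifs <;> norm_num
    have hnn' := mul_nonneg (hp y) hnn
    by_cases herr : ψ A (A.mulVec y) ≠ y
    · rw [Set.indicator_of_mem (by exact herr)]
      by_cases hy : y ∈ S
      · obtain ⟨h1, h2⟩ := hψ A y hy
        have : (1 : ℝ) ≤ ∑ y' ∈ S, if y' - y ≠ 0 ∧ A.mulVec (y' - y) = 0 then 1 else 0 := by
          refine le_trans ?_ (Finset.single_le_sum
            (fun _ _ => by split_ifs <;> norm_num) h1)
          rw [if_pos ⟨sub_ne_zero.2 herr, by rw [Matrix.mulVec_sub, h2, sub_self]⟩]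
        simp only [hy, not_true_eq_false, if_false, zero_add]
        exact le_mul_of_one_le_right (hp y) this
      · rw [if_pos hy]; linarith
    · rw [Set.indicator_of_notMem (by exact herr)]
      have := hp y
      split_ifs <;> linarith
  have hcount : ∀ z : Fin n → F,
      ∑ A : Matrix (Fin k) (Fin n) F, (if z ≠ 0 ∧ A.mulVec z = 0 then (1 : ℝ) else 0) ≤
        c / (Fintype.card F : ℝ) ^ k := by
    intro z
    by_cases hz : z = 0
    · simp only [hz, ne_eq, not_true_eq_false, false_and, if_false, Finset.sum_const_zero]
      positivity
    · rw [le_div_iff₀ hq]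
      simp only [ne_eq, hz, not_false_eq_true, true_and, Finset.sum_boole]
      simp only [c]
      exact_mod_cast (card_mulVec_eq_zero_mul hz).le
  have hsum : ∑ A : Matrix (Fin k) (Fin n) F,
      ∑ y, Set.indicator {y | ψ A (A.mulVec y) ≠ y} p y ≤
        ∑ _A : Matrix (Fin k) (Fin n) F,
          (∑ y with y ∉ S, p y + #S / (Fintype.card F : ℝ) ^ k) := by
    calc _ ≤ ∑ A : Matrix (Fin k) (Fin n) F, ∑ y, ((if y ∉ S then p y else 0) +
          p y * ∑ y' ∈ S, if y' - y ≠ 0 ∧ A.mulVec (y' - y) = 0 then 1 else 0) :=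
          Finset.sum_le_sum fun A _ => Finset.sum_le_sum fun y _ => hpt A y
      _ = c * ∑ y with y ∉ S, p y + ∑ y, p y * ∑ y' ∈ S, ∑ A : Matrix (Fin k) (Fin n) F,
            if y' - y ≠ 0 ∧ A.mulVec (y' - y) = 0 then 1 else 0 := by
          simp only [Finset.sum_add_distrib, Finset.sum_const, Finset.card_univ, nsmul_eq_mul,
            Finset.sum_filter]
          congr 1
          rw [Finset.sum_comm]
          refine Finset.sum_congr rfl fun y _ => ?_
          rw [← Finset.mul_sum, Finset.sum_comm]
      _ ≤ c * ∑ y with y ∉ S, p y + ∑ y, p y * ∑ _y' ∈ S, c / (Fintype.card F : ℝ) ^ k := by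
          gcongr with y _ y' _
          · exact hp y
          · exact hcount _
      _ = _ := by
          rw [← Finset.sum_mul, hp1]
          simp only [Finset.sum_const, Finset.card_univ, nsmul_eq_mul, c]
          ring
  obtain ⟨A, -, hA⟩ := Finset.exists_le_of_sum_le Finset.univ_nonempty hsum
  exact ⟨A, ψ A, hA⟩

end RandomLinearCoding

theorem inv_card_pow_floor_le {F : Type*} [Fintype F] [Nontrivial F] {R : ℝ} (n : ℕ) :
    ((Fintype.card F : ℝ) ^ ⌊n * R / Real.logb 2 (Fintype.card F)⌋₊)⁻¹ ≤
      Fintype.card F * (2 : ℝ) ^ (-(n * R)) := by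
  have hq : (1 : ℝ) < Fintype.card F := by exact_mod_cast Fintype.one_lt_card
  have hL : 0 < Real.logb 2 (Fintype.card F) := Real.logb_pos one_lt_two hq
  have hqL : (2 : ℝ) ^ Real.logb 2 (Fintype.card F) = Fintype.card F :=
    Real.rpow_logb two_pos (by norm_num) (by linarith)
  set k := ⌊n * R / Real.logb 2 (Fintype.card F)⌋₊
  have hk : n * R < (k + 1) * Real.logb 2 (Fintype.card F) :=
    (div_lt_iff₀ hL).1 (Nat.lt_floor_add_one _)
  nth_rewrite 1 2 [← hqL]
  rw [← Real.rpow_natCast, ← Real.rpow_mul two_pos.le, ← Real.rpow_neg two_pos.le,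
    ← Real.rpow_add two_pos]
  exact Real.rpow_le_rpow_of_exponent_le one_le_two (by linarith)

section TypicalSet

variable {X : Type*} [Fintype X]

theorem sum_pathProb {P : X → X → ℝ} {π : X → ℝ} (hP : IsStochasticMat P)
    (hπ : IsInvariantDist P π) (m : ℕ) :
    ∑ y : Fin (m + 1) → X, pathProb π P (List.ofFn y) = 1 := by
  rw [sum_ofFn_succ m (pathProb π P)]
  simp only [pathProb_cons, ← Finset.mul_sum, sum_pathWeight hP, mul_one, hπ.2.1]

theorem pathProb_ofFn_nonneg {P : X → X → ℝ} {π : X → ℝ} (hP : IsStochasticMat P)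
    (hπ : IsInvariantDist P π) {m : ℕ} (y : Fin (m + 1) → X) :
    0 ≤ pathProb π P (List.ofFn y) := by
  rw [List.ofFn_succ, pathProb_cons]
  exact mul_nonneg (hπ.1 _) (pathWeight_nonneg hP.1 _ _)

open Classical in
/-- Paths whose weight, given their first state, is at least `t`. -/
noncomputable def heavyPaths (P : X → X → ℝ) (t : ℝ) (m : ℕ) : Finset (Fin (m + 1) → X) :=
  {y | t ≤ pathWeight P (y 0) (List.ofFn (Fin.tail y))}

theorem card_heavyPaths_le {P : X → X → ℝ} (hP : IsStochasticMat P) {t : ℝ} (ht : 0 < t)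
    (m : ℕ) : (#(heavyPaths P t m) : ℝ) ≤ Fintype.card X / t := by
  rw [le_div_iff₀ ht, ← nsmul_eq_mul, ← Finset.sum_const]
  calc ∑ _y ∈ heavyPaths P t m, t
      ≤ ∑ y ∈ heavyPaths P t m, pathWeight P (y 0) (List.ofFn (Fin.tail y)) :=
        Finset.sum_le_sum fun y hy => (Finset.mem_filter.1 hy).2
    _ ≤ ∑ y : Fin (m + 1) → X, pathWeight P (y 0) (List.ofFn (Fin.tail y)) :=
        Finset.sum_le_sum_of_subset_of_nonneg (Finset.subset_univ _) fun y _ _ =>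
          pathWeight_nonneg hP.1 _ _
    _ = Fintype.card X := by
        rw [← (Fin.consEquiv fun _ : Fin (m + 1) => X).sum_comp, Fintype.sum_prod_type]
        simp [Fin.consEquiv, sum_pathWeight hP]

theorem sum_pathProb_compl_heavyPaths_le {P : X → X → ℝ} {π : X → ℝ} [DecidableEq X]
    (hπ : IsInvariantDist P π) {t a : ℝ} {m : ℕ}
    (h : ∀ i, ∑ y : Fin m → X with pathWeight P i (List.ofFn y) < t,
      pathWeight P i (List.ofFn y) ≤ a) :
    ∑ y with y ∉ heavyPaths P t m, pathProb π P (List.ofFn y) ≤ a := by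
  classical
  rw [Finset.sum_filter, ← (Fin.consEquiv fun _ : Fin (m + 1) => X).sum_comp,
    Fintype.sum_prod_type]
  calc _ = ∑ i, π i * ∑ y : Fin m → X with pathWeight P i (List.ofFn y) < t,
        pathWeight P i (List.ofFn y) := by
        refine Finset.sum_congr rfl fun i _ => ?_
        rw [Finset.sum_filter, Finset.mul_sum]
        refine Finset.sum_congr rfl fun y _ => ?_
        simp [Fin.consEquiv, heavyPaths, List.ofFn_succ, pathProb_cons]
    _ ≤ ∑ i, π i * a := Finset.sum_le_sum fun i _ => mul_le_mul_of_nonneg_left (h i) (hπ.1 i)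
    _ = a := by rw [← Finset.sum_mul, hπ.2.1, one_mul]

end TypicalSet

/-- Linear coding over a finite field achieves every rate `R > H(P|π)` for an
irreducible Markov source whose state space is the field. -/
theorem stmt10 {F : Type*} [Field F] [Fintype F] [DecidableEq F]
    (P : F → F → ℝ) (π : F → ℝ)
    (hP : IsStochasticMat P) (hirr : IsIrreducibleMat P) (hπ : IsInvariantDist P π) :
    ∀ R : ℝ, mcCondEnt P π < R →
      ∀ ε > (0 : ℝ), ∃ N₀ : ℕ+, ∀ n : ℕ, (N₀ : ℕ) < n →
        ∃ (k : ℕ) (A : Matrix (Fin k) (Fin n) F) (ψ : (Fin k → F) → (Fin n → F)),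
          (k : ℝ) * Real.logb 2 (Fintype.card F) ≤ (n : ℝ) * R ∧
          ∑ y : Fin n → F,
            Set.indicator {y : Fin n → F | ψ (A.mulVec y) ≠ y}
              (fun y => pathProb π P (List.ofFn y)) y < ε := by
  intro R hR ε hε
  set H := mcCondEnt P π
  have hH0 : 0 ≤ H := mcCondEnt_nonneg hP hπ
  obtain ⟨δ, hδ, hRδ⟩ : ∃ δ > 0, R = H + 2 * δ := ⟨(R - H) / 2, by linarith, by ring⟩
  obtain ⟨C, M, hCM⟩ := exists_sum_low_pathWeight_le hP hirr hπ hδ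
  set q : ℝ := (Fintype.card F : ℝ)
  have hq : 1 < q := Nat.one_lt_cast.2 Fintype.one_lt_card
  have hL : 0 < Real.logb 2 q := Real.logb_pos one_lt_two hq
  have hlim : Filter.Tendsto (fun m : ℕ => C / m + q ^ 2 * ((2 : ℝ) ^ (-δ)) ^ m)
      Filter.atTop (nhds (0 + q ^ 2 * 0)) :=
    (tendsto_const_div_atTop_nhds_zero_nat C).add
      ((tendsto_pow_atTop_nhds_zero_of_lt_one (by positivity)
        (Real.rpow_lt_one_of_one_lt_of_neg one_lt_two (by linarith))).const_mul _)
  rw [mul_zero, add_zero] at hlim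
  obtain ⟨N, hN⟩ := Filter.eventually_atTop.1 ((hlim.eventually_lt_const hε).and
    (tendsto_natCast_atTop_atTop.eventually_gt_atTop M))
  refine ⟨N.succPNat, fun n hn => ?_⟩
  obtain ⟨m, rfl⟩ : ∃ m, n = m + 1 := ⟨n - 1, by simp at hn; omega⟩
  obtain ⟨hsmall, hM⟩ := hN m (by simp at hn; omega)
  set t : ℝ := (2 : ℝ) ^ (-(m * (H + δ))) with ht_def
  have ht : 0 < t := by positivity
  obtain ⟨A, ψ, hA⟩ := exists_linear_code
    (k := ⌊((m + 1 : ℕ) : ℝ) * R / Real.logb 2 (Fintype.card F)⌋₊) (heavyPaths P t m)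
    (pathProb_ofFn_nonneg hP hπ) (sum_pathProb hP hπ m)
  refine ⟨_, A, ψ, ?_, hA.trans_lt (lt_of_le_of_lt (add_le_add
    (sum_pathProb_compl_heavyPaths_le hπ (hCM m hM)) ?_) hsmall)⟩
  · rw [← le_div_iff₀ hL]
    exact Nat.floor_le (div_nonneg (mul_nonneg (Nat.cast_nonneg _) (by linarith)) hL.le)
  · rw [div_eq_mul_inv]
    calc _ ≤ q / t * (q * (2 : ℝ) ^ (-(((m + 1 : ℕ) : ℝ) * R))) :=
          mul_le_mul (card_heavyPaths_le hP ht m) (inv_card_pow_floor_le _) (by positivity)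
            (by positivity)
      _ = q ^ 2 * (2 : ℝ) ^ (m * (H + δ) - ((m + 1 : ℕ) : ℝ) * R) := by
          rw [ht_def, Real.rpow_neg two_pos.le, div_inv_eq_mul, sub_eq_add_neg,
            Real.rpow_add two_pos]
          ring
      _ ≤ q ^ 2 * ((2 : ℝ) ^ (-δ)) ^ m := by
          rw [← Real.rpow_mul_natCast two_pos.le]
          gcongr
          · exact one_le_two
          · push_cast
            rw [hRδ]
            linarith
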